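/- Let B ∈ V(A'(T)) and let r, t, s ∈ B with s ≤ t ≤ r and (r,t), (t,s) ∈ Cg^B(c,d) for some c, d ∈ B. Suppose there are constants p_1, p_2, q_1, q_2 ∈ B such that r = J(p_1,q_1,r), t = J(p_1,q_1,t) = J'(p_2,q_2,t'), and s = J'(p_2,q_2,s'), where t' = e_i(n̄,t) and s' = e_i(n̄,s) for some i ∈ {0,1,2} and n̄ ∈ B² ∪ B. Then there exist constants ρ, u ∈ B such that r = J'(r,ρ,r'), u = J'(r,ρ,s') = J(u,ρ,r''), and s = J(u,ρ,s''), where r' = e_i(n̄,r), r'' = e2(r,ρ,r), and s'' = e2(r,ρ,s). (That is, every J–J' chain can be replaced by a J'–J chain with the same endpoints.) -/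

import Mathlib

open FirstOrder

namespace McKenzie

/-- A Turing machine instruction `(s, r, w, d, t)`: "in state `s` reading `r`,
write `w`, move in direction `d` (`true` = right, `false` = left), enter state `t`". -/
structure Instr (n : ℕ) where
  s : Fin (n + 1)
  r : Bool
  w : Bool
  d : Bool
  t : Fin (n + 1)

/-- A Turing machine: a finite list of instructions on states `μ0, …, μn`
(represented by `Fin (states+1)`), where `μ0` is the halting state (carrying no
instructions) and `μ1` is the initial state. -/
structure TM where
  states : ℕ
  instr : List (Instr states)
  halt_no_instr : ∀ i ∈ instr, i.s ≠ 0

/-- A configuration of a Turing machine: a tape, a head position and a state. -/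
structure Cfg (T : TM) where
  tape : ℤ → Bool
  head : ℤ
  state : Fin (T.states + 1)

/-- One computation step of the machine (using the first applicable instruction). -/
def TM.step (T : TM) (Q : Cfg T) : Option (Cfg T) :=
  match T.instr.find? (fun i => decide (i.s = Q.state ∧ i.r = Q.tape Q.head)) with
  | none => none
  | some i =>
      some ⟨Function.update Q.tape Q.head i.w,
        if i.d then Q.head + 1 else Q.head - 1, i.t⟩

/-- The configuration after `n` steps when started in state `μ1` on the blank tape. -/
def TM.run (T : TM) : ℕ → Option (Cfg T)
  | 0 => some ⟨fun _ => false, 0, 1⟩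
  | n + 1 => (T.run n).bind T.step

/-- `T` halts (started in the initial state `μ1` on the empty, all-zero, tape). -/
def TM.Halts (T : TM) : Prop := ∃ (n : ℕ) (Q : Cfg T), T.run n = some Q ∧ Q.state = 0

/-- The universe of the algebra `A'(T)`:
`0`, `U = {1,2,H}`, `W = {C, D, ∂C, ∂D}`, and
`V = {C_ir^s, D_ir^s, M_i^r}` together with their barred versions. -/
inductive El (T : TM) : Type
  | zero
  | one
  | two
  | H
  | C (bar : Bool)
  | D (bar : Bool)
  | Cv (bar : Bool) (i : Fin (T.states + 1)) (r s : Bool)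
  | Dv (bar : Bool) (i : Fin (T.states + 1)) (r s : Bool)
  | Mv (bar : Bool) (i : Fin (T.states + 1)) (r : Bool)
  deriving DecidableEq

namespace El

variable {T : TM}

/-- The bar involution `∂`, defined (only) on `V ∪ W`. -/
def bar : El T → Option (El T)
  | C b => some (C (!b))
  | D b => some (D (!b))
  | Cv b i r s => some (Cv (!b) i r s)
  | Dv b i r s => some (Dv (!b) i r s)
  | Mv b i r => some (Mv (!b) i r)
  | _ => none

/-- The flat (height 1) semilattice meet with bottom element `0`. -/
def meet (x y : El T) : El T := if x = y then x else zero

/-- Join in the flat semilattice, for comparable elements. -/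
def fjoin (x y : El T) : El T := if x = zero then y else x

/-- The nonassociative multiplication: `2·D = H·C = D`, `1·C = C`,
`2·∂D = H·∂C = ∂D`, `1·∂C = ∂C`, and `0` otherwise. -/
def mul : El T → El T → El T
  | two, D b => D b
  | H, C b => D b
  | one, C b => C b
  | _, _ => zero

/-- `J(x,y,z) = (x ∧ ∂y ∧ z) ∨ (x ∧ y)`. -/
def opJ (x y z : El T) : El T :=
  if x = y then x else if bar y = some x then meet x z else zero

/-- `J'(x,y,z) = (x ∧ y ∧ z) ∨ (x ∧ ∂y)`. -/
def opJ' (x y z : El T) : El T :=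
  if x = y then meet x z else if bar y = some x then x else zero

/-- `K(x,y,z) = (∂x ∧ y) ∨ (∂x ∧ ∂y ∧ z) ∨ (x ∧ y ∧ z)`. -/
def opK (x y z : El T) : El T :=
  if bar y = some x then y
  else if x = y ∧ bar z = some x then z
  else meet x (meet y z)

/-- `(x ∧ y) ∨ (x ∧ z)`. -/
def sCore (x y z : El T) : El T := fjoin (meet x y) (meet x z)

/-- Membership in `V₀` (the elements of `V` with state index `0`). -/
def isV0 : El T → Bool
  | Cv _ i _ _ => decide (i = 0)
  | Dv _ i _ _ => decide (i = 0)
  | Mv _ i _ => decide (i = 0)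
  | _ => false

/-- `S₀(u,x,y,z) = (x∧y) ∨ (x∧z)` if `u ∈ V₀`, else `0`. -/
def opS0 (u x y z : El T) : El T := if isV0 u then sCore x y z else zero

/-- `S₁(u,x,y,z) = (x∧y) ∨ (x∧z)` if `u ∈ {1,2}`, else `0`. -/
def opS1 (u x y z : El T) : El T := if u = one ∨ u = two then sCore x y z else zero

/-- `S₂(u,v,x,y,z) = (x∧y) ∨ (x∧z)` if `u = ∂v ∈ V ∪ W`, else `0`. -/
def opS2 (u v x y z : El T) : El T := if bar v = some u then sCore x y z else zero

/-- The operation `T(w,x,y,z)`. -/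
def opT (w x y z : El T) : El T :=
  if mul w x = mul y z then
    if w = y ∧ x = z then mul w x
    else if mul w x ≠ zero then (bar (mul w x)).getD zero else zero
  else zero

/-- `I(1) = C₁₀⁰`, `I(H) = M₁⁰`, `I(2) = D₁₀⁰`, and `0` otherwise. -/
def opI : El T → El T
  | one => Cv false 1 false false
  | H => Mv false 1 false
  | two => Dv false 1 false false
  | _ => zero

/-- The left-moving machine operation `L_{irt}` attached to an instruction
`(μ_i, r, s, L, μ_j)` and `t ∈ {0,1}`. -/
def opL (ins : Instr T.states) (t : Bool) : El T → El T → El T → El T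
  | one, one, Cv b i r s' => if i = ins.s ∧ r = ins.r then Cv b ins.t t s' else zero
  | H, one, Cv b i r s' => if i = ins.s ∧ r = ins.r ∧ s' = t then Mv b ins.t t else zero
  | two, H, Mv b i r => if i = ins.s ∧ r = ins.r then Dv b ins.t t ins.w else zero
  | two, two, Dv b i r s' => if i = ins.s ∧ r = ins.r then Dv b ins.t t s' else zero
  | _, _, _ => zero

/-- The right-moving machine operation `R_{irt}` attached to an instruction
`(μ_i, r, s, R, μ_j)` and `t ∈ {0,1}`. -/
def opR (ins : Instr T.states) (t : Bool) : El T → El T → El T → El T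
  | one, one, Cv b i r s' => if i = ins.s ∧ r = ins.r then Cv b ins.t t s' else zero
  | H, one, Mv b i r => if i = ins.s ∧ r = ins.r then Cv b ins.t t ins.w else zero
  | two, H, Dv b i r s' => if i = ins.s ∧ r = ins.r ∧ s' = t then Mv b ins.t t else zero
  | two, two, Dv b i r s' => if i = ins.s ∧ r = ins.r then Dv b ins.t t s' else zero
  | _, _, _ => zero

/-- The machine operation (from `𝓛 ∪ 𝓡`) attached to an instruction. -/
def mach (ins : Instr T.states) (t : Bool) (x y u : El T) : El T :=
  if ins.d then opR ins t x y u else opL ins t x y u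

/-- The relation `≺` on `{1,2,H}`. -/
def prec : El T → El T → Bool
  | two, two => true
  | two, H => true
  | one, one => true
  | _, _ => false

/-- The operation `U_F^1`. -/
def opU1 (F : El T → El T → El T → El T) (x y z u : El T) : El T :=
  if prec x z then
    if y = z then F x y u
    else if F x y u ≠ zero then (bar (F x y u)).getD zero else zero
  else zero

/-- The operation `U_F^0`. -/
def opU0 (F : El T → El T → El T → El T) (x y z u : El T) : El T :=
  if prec x z then
    if x = y then F y z u
    else if F y z u ≠ zero then (bar (F y z u)).getD zero else zero
  else zero

end El

/-- The unary operation symbols of `A'(T)`. -/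
inductive Ops1 : Type
  | I

/-- The binary operation symbols of `A'(T)`. -/
inductive Ops2 : Type
  | meet
  | mul

/-- The ternary operation symbols of `A'(T)`: `J`, `J'`, `K` and the machine
operations from `𝓛 ∪ 𝓡` (one for each instruction and each `t ∈ {0,1}`). -/
inductive Ops3 (T : TM) : Type
  | J
  | J'
  | K
  | mach (k : Fin T.instr.length) (t : Bool)

/-- The 4-ary operation symbols of `A'(T)`: `S₀`, `S₁`, `T` and the operations
`U_F^1, U_F^0` for `F ∈ 𝓛 ∪ 𝓡`. -/
inductive Ops4 (T : TM) : Type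
  | S0
  | S1
  | T
  | u1 (k : Fin T.instr.length) (t : Bool)
  | u0 (k : Fin T.instr.length) (t : Bool)

/-- The 5-ary operation symbols of `A'(T)`: `S₂`. -/
inductive Ops5 : Type
  | S2

/-- The signature (similarity type) of the algebra `A'(T)`; the constant symbol
(of arity 0) denotes the bottom element `0`. -/
def Sig (T : TM) : FirstOrder.Language.{0, 0} where
  Functions n :=
    match n with
    | 0 => PUnit
    | 1 => Ops1
    | 2 => Ops2
    | 3 => Ops3 T
    | 4 => Ops4 T
    | 5 => Ops5
    | _ => PEmpty
  Relations _ := PEmpty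


/-- The constant symbol `0` as an element of the signature. -/
def fn0 (T : TM) : (Sig T).Functions 0 := PUnit.unit
/-- Unary operation symbols as elements of the signature. -/
def fn1 (T : TM) (o : Ops1) : (Sig T).Functions 1 := o
/-- Binary operation symbols as elements of the signature. -/
def fn2 (T : TM) (o : Ops2) : (Sig T).Functions 2 := o
/-- Ternary operation symbols as elements of the signature. -/
def fn3 (T : TM) (o : Ops3 T) : (Sig T).Functions 3 := o
/-- 4-ary operation symbols as elements of the signature. -/
def fn4 (T : TM) (o : Ops4 T) : (Sig T).Functions 4 := o
/-- 5-ary operation symbols as elements of the signature. -/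
def fn5 (T : TM) (o : Ops5) : (Sig T).Functions 5 := o

/-- The algebra `A'(T)`: the interpretation of the signature `Sig T` on `El T`. -/
instance elStructure (T : TM) : (Sig T).Structure (El T) where
  funMap {n} f v :=
    match n, f, v with
    | 0, _, _ => El.zero
    | 1, Ops1.I, v => El.opI (v 0)
    | 2, Ops2.meet, v => El.meet (v 0) (v 1)
    | 2, Ops2.mul, v => El.mul (v 0) (v 1)
    | 3, Ops3.J, v => El.opJ (v 0) (v 1) (v 2)
    | 3, Ops3.J', v => El.opJ' (v 0) (v 1) (v 2)
    | 3, Ops3.K, v => El.opK (v 0) (v 1) (v 2)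
    | 3, Ops3.mach k t, v => El.mach (T.instr.get k) t (v 0) (v 1) (v 2)
    | 4, Ops4.S0, v => El.opS0 (v 0) (v 1) (v 2) (v 3)
    | 4, Ops4.S1, v => El.opS1 (v 0) (v 1) (v 2) (v 3)
    | 4, Ops4.T, v => El.opT (v 0) (v 1) (v 2) (v 3)
    | 4, Ops4.u1 k t, v => El.opU1 (El.mach (T.instr.get k) t) (v 0) (v 1) (v 2) (v 3)
    | 4, Ops4.u0 k t, v => El.opU0 (El.mach (T.instr.get k) t) (v 0) (v 1) (v 2) (v 3)
    | 5, Ops5.S2, v => El.opS2 (v 0) (v 1) (v 2) (v 3) (v 4)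
    | _ + 6, f, _ => f.elim
  RelMap {n} r _ := r.elim

/-- The product algebra `A'(T)^ι`. -/
instance piStructure (T : TM) (ι : Type*) : (Sig T).Structure (ι → El T) where
  funMap f v l := Language.Structure.funMap f fun i => v i l
  RelMap r _ := r.elim

open Language

/-- A congruence of an algebra: an equivalence relation compatible with all the
fundamental operations. -/
def IsCongruence (L : Language) (B : Type*) [L.Structure B] (ρ : B → B → Prop) : Prop :=
  Equivalence ρ ∧
    ∀ {n : ℕ} (f : L.Functions n) (v w : Fin n → B),
      (∀ i, ρ (v i) (w i)) → ρ (Structure.funMap f v) (Structure.funMap f w)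

/-- `PrinCg L B a b x y` says that `(x, y)` lies in the principal congruence
`Cg^B(a,b)` generated by the pair `(a,b)`. -/
def PrinCg (L : Language) (B : Type*) [L.Structure B] (a b x y : B) : Prop :=
  ∀ ρ : B → B → Prop, IsCongruence L B ρ → ρ a b → ρ x y

/-- `B` satisfies every identity holding in `A`; by Birkhoff's theorem this says
exactly that `B` belongs to the variety generated by `A`. -/
def ModelsIdsOf (L : Language) (A : Type*) [L.Structure A] (B : Type*) [L.Structure B] : Prop :=
  ∀ t₁ t₂ : L.Term ℕ,
    (∀ v : ℕ → A, t₁.realize v = t₂.realize v) →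
    ∀ v : ℕ → B, t₁.realize v = t₂.realize v

/-- Membership in the variety `V(A'(T))` generated by `A'(T)`. -/
def InVariety (T : TM) (B : Type*) [(Sig T).Structure B] : Prop :=
  ModelsIdsOf (Sig T) (El T) B

/-- The variety `V(A'(T))` as a class of algebras. -/
def VClass (T : TM) : ∀ (B : Type) [inst : (Sig T).Structure B], Prop :=
  fun B inst => @InVariety T B inst

/-- `φ(w,x,y,z)` is a congruence formula for the class `C`: in every member of `C`
it implies `(w,x) ∈ Cg(y,z)`. -/
def IsCongruenceFormula (L : Language) (C : ∀ (B : Type) [inst : L.Structure B], Prop)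
    (φ : L.Formula (Fin 4)) : Prop :=
  ∀ (B : Type) [L.Structure B], C B → ∀ w x y z : B,
    φ.Realize ![w, x, y, z] → PrinCg L B y z w x

/-- The class `C` has definable principal subcongruences: there are congruence
formulas `Γ` and `ψ` such that any pair `a ≠ b` admits a subpair `c ≠ d` of
`Cg(a,b)` (witnessed by `Γ`) whose principal congruence is defined by `ψ`. -/
def HasDPSC (L : Language) (C : ∀ (B : Type) [inst : L.Structure B], Prop) : Prop :=
  ∃ Γ ψ : L.Formula (Fin 4),
    IsCongruenceFormula L C Γ ∧ IsCongruenceFormula L C ψ ∧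
      ∀ (B : Type) [L.Structure B], C B → ∀ a b : B, a ≠ b →
        ∃ c d : B, c ≠ d ∧ Γ.Realize ![c, d, a, b] ∧
          ∀ x y : B, PrinCg L B c d x y ↔ ψ.Realize ![x, y, c, d]

/-- The variety `V(A'(T))` is axiomatized by a finite set of identities
(which hold in `A'(T)`). -/
def FinitelyBased (T : TM) : Prop :=
  ∃ E : List ((Sig T).Term ℕ × (Sig T).Term ℕ),
    (∀ e ∈ E, ∀ v : ℕ → El T, e.1.realize v = e.2.realize v) ∧
    ∀ (B : Type) [(Sig T).Structure B],
      (InVariety T B ↔ ∀ e ∈ E, ∀ v : ℕ → B, e.1.realize v = e.2.realize v)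

/-- An algebra is subdirectly irreducible iff some pair `a ≠ b` (generating the
monolith) belongs to every nontrivial congruence. -/
def IsSI (L : Language) (B : Type*) [L.Structure B] : Prop :=
  ∃ a b : B, a ≠ b ∧ ∀ c d : B, c ≠ d → PrinCg L B c d a b

/-- An algebra is finitely subdirectly irreducible iff any two nontrivial principal
congruences have nontrivial intersection. -/
def IsFSI (L : Language) (B : Type*) [L.Structure B] : Prop :=
  ∀ a b c d : B, a ≠ b → c ≠ d →
    ∃ x y : B, x ≠ y ∧ PrinCg L B a b x y ∧ PrinCg L B c d x y

/-- The residual bound of `V(A'(T))` is finite (`κ(A'(T)) < ω`): there is a finite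
bound strictly larger than the cardinality of every subdirectly irreducible member. -/
def ResBoundFinite (T : TM) : Prop :=
  ∃ N : ℕ, ∀ (B : Type) [(Sig T).Structure B],
    InVariety T B → IsSI (Sig T) B → Finite B ∧ Nat.card B < N

/-- Membership in `HS(A'(T))`: homomorphic images of subalgebras of `A'(T)`. -/
def InHS (T : TM) (B : Type*) [(Sig T).Structure B] : Prop :=
  ∃ (S : (Sig T).Substructure (El T)) (f : S →[Sig T] B), Function.Surjective f

/-- The constant `0` of an algebra in the signature of `A'(T)`. -/
def zeroB (T : TM) (B : Type*) [(Sig T).Structure B] : B :=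
  Structure.funMap (fn0 T) (fun i : Fin 0 => i.elim0)

/-- The meet operation of an algebra in the signature of `A'(T)`. -/
def meetB (T : TM) {B : Type*} [(Sig T).Structure B] (x y : B) : B :=
  Structure.funMap (fn2 T Ops2.meet) ![x, y]

/-- The multiplication of an algebra in the signature of `A'(T)`. -/
def mulB (T : TM) {B : Type*} [(Sig T).Structure B] (x y : B) : B :=
  Structure.funMap (fn2 T Ops2.mul) ![x, y]

/-- The operation `I` of an algebra in the signature of `A'(T)`. -/
def IB (T : TM) {B : Type*} [(Sig T).Structure B] (x : B) : B :=
  Structure.funMap (fn1 T Ops1.I) ![x]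

/-- The operation `J` of an algebra in the signature of `A'(T)`. -/
def JB (T : TM) {B : Type*} [(Sig T).Structure B] (x y z : B) : B :=
  Structure.funMap (fn3 T Ops3.J) ![x, y, z]

/-- The operation `J'` of an algebra in the signature of `A'(T)`. -/
def J'B (T : TM) {B : Type*} [(Sig T).Structure B] (x y z : B) : B :=
  Structure.funMap (fn3 T Ops3.J') ![x, y, z]

/-- The operation `K` of an algebra in the signature of `A'(T)`. -/
def KB (T : TM) {B : Type*} [(Sig T).Structure B] (x y z : B) : B :=
  Structure.funMap (fn3 T Ops3.K) ![x, y, z]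

/-- The operation `S₂` of an algebra in the signature of `A'(T)`. -/
def S2B (T : TM) {B : Type*} [(Sig T).Structure B] (u v x y z : B) : B :=
  Structure.funMap (fn5 T Ops5.S2) ![u, v, x, y, z]

/-- The term `e₂(m,n,x) = S₂(m,n,x,x,x)`. -/
def e2B (T : TM) {B : Type*} [(Sig T).Structure B] (m n x : B) : B :=
  S2B T m n x x x

/-- The semilattice order of an algebra in the signature of `A'(T)`:
`x ≤ y` iff `x ∧ y = x`. -/
def leB (T : TM) {B : Type*} [(Sig T).Structure B] (x y : B) : Prop :=
  meetB T x y = x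

/-- Parameters `m̄ ∈ B² ∪ B` for one of the operations `S₀`, `S₁`, `S₂`. -/
inductive SIdx (B : Type*) : Type _
  | s0 (m : B)
  | s1 (m : B)
  | s2 (m n : B)

/-- Which of `S₀, S₁, S₂` a parameter tuple belongs to. -/
def SIdx.tag {B : Type*} : SIdx B → Fin 3
  | .s0 _ => 0
  | .s1 _ => 1
  | .s2 _ _ => 2

/-- `SApp T σ x y z` is `S_i(m̄, x, y, z)` where `σ` packages `i` and `m̄`. -/
def SApp (T : TM) {B : Type*} [(Sig T).Structure B] : SIdx B → B → B → B → B
  | .s0 m, x, y, z => Structure.funMap (fn4 T Ops4.S0) ![m, x, y, z]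
  | .s1 m, x, y, z => Structure.funMap (fn4 T Ops4.S1) ![m, x, y, z]
  | .s2 m n, x, y, z => S2B T m n x y z

/-- `eApp T σ x` is the term function `e_i(m̄, x) = S_i(m̄, x, x, x)`. -/
def eApp (T : TM) {B : Type*} [(Sig T).Structure B] (σ : SIdx B) (x : B) : B :=
  SApp T σ x x x

/-- `Range(S_j)`: the set of values of the operation `S_j` on `B`. -/
def SRange (T : TM) (B : Type*) [(Sig T).Structure B] (j : Fin 3) : Set B :=
  {w | ∃ (σ : SIdx B) (x y z : B), σ.tag = j ∧ SApp T σ x y z = w}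

/-- A unary polynomial of `B`: a term function in one variable with parameters
from `B`. -/
def IsPolynomial (T : TM) {B : Type*} [(Sig T).Structure B] (f : B → B) : Prop :=
  ∃ t : (Sig T).Term (B ⊕ Unit), ∀ x : B, f x = t.realize (Sum.elim id fun _ => x)

/-- A fundamental translation: a unary polynomial obtained from a fundamental
operation by fixing all arguments but one. -/
def IsFundTranslation (T : TM) {B : Type*} [(Sig T).Structure B] (g : B → B) : Prop :=
  ∃ (n : ℕ) (F : (Sig T).Functions n) (i : Fin n) (v : Fin n → B),
    g = fun x => Structure.funMap F (Function.update v i x)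

/-- A polynomial generated by fundamental translations: a composition of finitely
many fundamental translations. -/
inductive IsTransPoly (T : TM) {B : Type*} [(Sig T).Structure B] : (B → B) → Prop
  | id : IsTransPoly T id
  | comp {g f : B → B} : IsFundTranslation T g → IsTransPoly T f → IsTransPoly T (g ∘ f)

end McKenzie

namespace McKenzie

open Language

section

variable {T : TM}

namespace El

theorem bar_symm {x y : El T} (h : bar x = some y) : bar y = some x := by
  cases x <;> simp [bar] at h <;> subst h <;> simp [bar]

@[simp]
theorem bar_ne_self (x : El T) : bar x ≠ some x := by
  cases x <;> simp [bar]

@[simp]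
theorem bar_zero : bar (zero : El T) = none := rfl

@[simp]
theorem bar_ne_zero (x : El T) : bar x ≠ some zero := by
  cases x <;> simp [bar]

@[simp]
theorem sCore_self (x : El T) : sCore x x x = x := by
  simp [sCore, meet, fjoin]

theorem eApp_eq_ite (σ : SIdx (El T)) :
    ∃ b : Prop, ∀ x, eApp T σ x = open Classical in if b then x else zero := by
  classical
  cases σ with
  | s0 m => exact ⟨isV0 m, fun x => by
      change opS0 m x x x = _
      simp [opS0]⟩
  | s1 m => exact ⟨m = one ∨ m = two, fun x => by
      change opS1 m x x x = _
      simp [opS1]⟩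
  | s2 m n => exact ⟨bar n = some m, fun x => by
      change opS2 m n x x x = _
      simp [opS2]⟩

theorem meetB_eq (x y : El T) : meetB T x y = meet x y := rfl

theorem JB_eq (x y z : El T) : JB T x y z = opJ x y z := rfl

theorem J'B_eq (x y z : El T) : J'B T x y z = opJ' x y z := rfl

theorem KB_eq (x y z : El T) : KB T x y z = opK x y z := rfl

theorem e2B_eq (x y z : El T) :
    e2B T x y z = if bar y = some x then z else zero := by
  change opS2 x y z z z = _
  simp [opS2]

theorem meetB_self (x : El T) : meetB T x x = x := by
  simp [meetB_eq, meet]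

theorem J'B_JB_JB (p q x y : El T) :
    J'B T (JB T p q x) q (JB T p q y) = JB T p q x := by
  simp only [J'B_eq, JB_eq, opJ, opJ', meet]
  grind [bar_symm, bar_ne_self, bar_zero, bar_ne_zero]

theorem meetB_J'B (x y z : El T) : meetB T x (J'B T x y z) = J'B T x y z := by
  simp only [meetB_eq, J'B_eq, opJ', meet]
  grind

theorem J'B_le_J'B_KB (p q p' q' x y : El T) (σ : SIdx (El T)) :
    meetB T (J'B T (JB T p q x) q (J'B T p' q' (eApp T σ (JB T p q y))))
        (J'B T (JB T p q x) (KB T (JB T p q x) q q') (eApp T σ (JB T p q x))) =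
      J'B T (JB T p q x) q (J'B T p' q' (eApp T σ (JB T p q y))) := by
  obtain ⟨b, hb⟩ := eApp_eq_ite σ
  simp only [hb, meetB_eq, J'B_eq, JB_eq, KB_eq, opJ, opJ', opK, meet]
  grind [bar_symm, bar_ne_self, bar_zero, bar_ne_zero]

theorem JB_J'B_e2B (r y x : El T) :
    JB T (J'B T r y x) y (e2B T r y r) = J'B T r y x := by
  simp only [e2B_eq, J'B_eq, JB_eq, opJ, opJ', meet]
  grind [bar_symm, bar_ne_self, bar_zero, bar_ne_zero]

theorem JB_J'B_e2B_le (r y x t : El T) (σ : SIdx (El T)) :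
    meetB T (meetB T x (meetB T t r))
        (JB T (J'B T r y (eApp T σ (meetB T x (meetB T t r)))) y
          (e2B T r y (meetB T x (meetB T t r)))) =
      JB T (J'B T r y (eApp T σ (meetB T x (meetB T t r)))) y
        (e2B T r y (meetB T x (meetB T t r))) := by
  obtain ⟨b, hb⟩ := eApp_eq_ite σ
  simp only [hb, e2B_eq, meetB_eq, J'B_eq, JB_eq, opJ, opJ', meet]
  grind [bar_symm, bar_ne_self, bar_zero, bar_ne_zero]

theorem le_JB_J'B_e2B (p q p' q' z t x : El T) (σ : SIdx (El T)) :
    let r := JB T p q z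
    let y := KB T r q q'
    let s := meetB T x (meetB T t r)
    let w := meetB T (J'B T p' q' (eApp T σ s)) s
    meetB T w (JB T (J'B T r y (eApp T σ s)) y (e2B T r y s)) = w := by
  obtain ⟨b, hb⟩ := eApp_eq_ite σ
  intro r y s w
  have hr : r = zero ∨ (r = p ∧ p = q) ∨ (r = p ∧ bar q = some p) := by
    simp only [r, JB_eq, opJ, meet]
    grind
  have hs : s = zero ∨ s = r := by
    simp only [s, meetB_eq, meet]
    grind
  simp only [w, y, hb, e2B_eq, meetB_eq, J'B_eq, JB_eq, KB_eq, opK, opJ, opJ', meet]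
  clear_value r s
  grind [bar_symm, bar_ne_self, bar_zero, bar_ne_zero]

end El

/-- The term algebra. -/
instance termStructure (T : TM) (α : Type*) : (Sig T).Structure ((Sig T).Term α) where
  funMap f v := Term.func f v
  RelMap r _ := r.elim

/-- The image of a parameter tuple under a map. -/
def SIdx.map {A B : Type*} (f : A → B) : SIdx A → SIdx B
  | .s0 m => .s0 (f m)
  | .s1 m => .s1 (f m)
  | .s2 m n => .s2 (f m) (f n)

theorem comp_vecCons {α β : Type*} {n : ℕ} (f : α → β) (a : α) (u : Fin n → α) :
    f ∘ Matrix.vecCons a u = Matrix.vecCons (f a) (f ∘ u) :=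
  Fin.comp_cons f a u

theorem comp_vecEmpty {α β : Type*} (f : α → β) (u : Fin 0 → α) : f ∘ u = ![] :=
  Subsingleton.elim _ _

section Realize

variable {α A : Type*} [(Sig T).Structure A] (v : α → A) (a b c : (Sig T).Term α)

theorem realize_funMap {n : ℕ} (f : (Sig T).Functions n) (u : Fin n → (Sig T).Term α) :
    (Structure.funMap f u : (Sig T).Term α).realize v =
      Structure.funMap f ((Term.realize v) ∘ u) := rfl

theorem realize_meetB : (meetB T a b).realize v = meetB T (a.realize v) (b.realize v) := by
  simp [meetB, realize_funMap, comp_vecCons, comp_vecEmpty]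

theorem realize_JB :
    (JB T a b c).realize v = JB T (a.realize v) (b.realize v) (c.realize v) := by
  simp [JB, realize_funMap, comp_vecCons, comp_vecEmpty]

theorem realize_J'B :
    (J'B T a b c).realize v = J'B T (a.realize v) (b.realize v) (c.realize v) := by
  simp [J'B, realize_funMap, comp_vecCons, comp_vecEmpty]

theorem realize_KB :
    (KB T a b c).realize v = KB T (a.realize v) (b.realize v) (c.realize v) := by
  simp [KB, realize_funMap, comp_vecCons, comp_vecEmpty]

theorem realize_e2B :
    (e2B T a b c).realize v = e2B T (a.realize v) (b.realize v) (c.realize v) := by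
  simp [e2B, S2B, realize_funMap, comp_vecCons, comp_vecEmpty]

theorem realize_eApp (σ : SIdx ((Sig T).Term α)) :
    (eApp T σ a).realize v = eApp T (σ.map (Term.realize v)) (a.realize v) := by
  cases σ <;> simp [eApp, SApp, S2B, SIdx.map, realize_funMap, comp_vecCons, comp_vecEmpty]

end Realize

/-- Every tuple of elements is the value of a tuple of terms. -/
theorem exists_valuation {B : Type*} [(Sig T).Structure B] (σ : SIdx B)
    (a b c d e f g : B) :
    ∃ (v : ℕ → B) (τ : SIdx ((Sig T).Term ℕ)) (a' b' c' d' e' f' g' : (Sig T).Term ℕ),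
      τ.map (Term.realize v) = σ ∧ a'.realize v = a ∧ b'.realize v = b ∧
      c'.realize v = c ∧ d'.realize v = d ∧ e'.realize v = e ∧ f'.realize v = f ∧
      g'.realize v = g := by
  let w (m n : B) : ℕ → B
    | 0 => a | 1 => b | 2 => c | 3 => d | 4 => e | 5 => f | 6 => g | 7 => m | _ => n
  suffices ∃ (m n : B) (τ : SIdx ((Sig T).Term ℕ)), τ.map (Term.realize (w m n)) = σ by
    obtain ⟨m, n, τ, hτ⟩ := this
    exact ⟨w m n, τ, .var 0, .var 1, .var 2, .var 3, .var 4, .var 5, .var 6, hτ,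
      rfl, rfl, rfl, rfl, rfl, rfl, rfl⟩
  cases σ with
  | s0 m => exact ⟨m, m, .s0 (.var 7), rfl⟩
  | s1 m => exact ⟨m, m, .s1 (.var 7), rfl⟩
  | s2 m n => exact ⟨m, n, .s2 (.var 7) (.var 8), rfl⟩

namespace InVariety

variable {B : Type*} [(Sig T).Structure B]

theorem meetB_self (hB : InVariety T B) (x : B) :
    meetB T x x = x := by
  obtain ⟨v, -, x, -, -, -, -, -, -, -, rfl, -, -, -, -, -, -⟩ :=
    exists_valuation (T := T) (.s0 x) x x x x x x x
  simp only [← realize_meetB]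
  refine hB _ _ (fun v => ?_) v
  simp only [realize_meetB]
  exact El.meetB_self _

theorem J'B_JB_JB (hB : InVariety T B) (p q x y : B) :
    J'B T (JB T p q x) q (JB T p q y) = JB T p q x := by
  obtain ⟨v, -, p, q, x, y, -, -, -, -, rfl, rfl, rfl, rfl, -, -, -⟩ :=
    exists_valuation (T := T) (.s0 p) p q x y p p p
  simp only [← realize_JB, ← realize_J'B]
  refine hB _ _ (fun v => ?_) v
  simp only [realize_JB, realize_J'B]
  exact El.J'B_JB_JB _ _ _ _

theorem meetB_J'B (hB : InVariety T B) (x y z : B) :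
    meetB T x (J'B T x y z) = J'B T x y z := by
  obtain ⟨v, -, x, y, z, -, -, -, -, -, rfl, rfl, rfl, -, -, -, -⟩ :=
    exists_valuation (T := T) (.s0 x) x y z x x x x
  simp only [← realize_meetB, ← realize_J'B]
  refine hB _ _ (fun v => ?_) v
  simp only [realize_meetB, realize_J'B]
  exact El.meetB_J'B _ _ _

theorem J'B_le_J'B_KB (hB : InVariety T B) (p q p' q' x y : B) (σ : SIdx B) :
    meetB T (J'B T (JB T p q x) q (J'B T p' q' (eApp T σ (JB T p q y))))
        (J'B T (JB T p q x) (KB T (JB T p q x) q q') (eApp T σ (JB T p q x))) =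
      J'B T (JB T p q x) q (J'B T p' q' (eApp T σ (JB T p q y))) := by
  obtain ⟨v, τ, p, q, p', q', x, y, -, rfl, rfl, rfl, rfl, rfl, rfl, rfl, -⟩ :=
    exists_valuation (T := T) σ p q p' q' x y p
  simp only [← realize_meetB, ← realize_JB, ← realize_J'B, ← realize_KB, ← realize_eApp]
  refine hB _ _ (fun v => ?_) v
  simp only [realize_meetB, realize_JB, realize_J'B, realize_KB, realize_eApp]
  exact El.J'B_le_J'B_KB _ _ _ _ _ _ _

theorem JB_J'B_e2B (hB : InVariety T B) (r y x : B) :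
    JB T (J'B T r y x) y (e2B T r y r) = J'B T r y x := by
  obtain ⟨v, -, r, y, x, -, -, -, -, -, rfl, rfl, rfl, -, -, -, -⟩ :=
    exists_valuation (T := T) (.s0 r) r y x r r r r
  simp only [← realize_JB, ← realize_J'B, ← realize_e2B]
  refine hB _ _ (fun v => ?_) v
  simp only [realize_JB, realize_J'B, realize_e2B]
  exact El.JB_J'B_e2B _ _ _

theorem JB_J'B_e2B_le (hB : InVariety T B) (r y x t : B) (σ : SIdx B) :
    meetB T (meetB T x (meetB T t r))
        (JB T (J'B T r y (eApp T σ (meetB T x (meetB T t r)))) y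
          (e2B T r y (meetB T x (meetB T t r)))) =
      JB T (J'B T r y (eApp T σ (meetB T x (meetB T t r)))) y
          (e2B T r y (meetB T x (meetB T t r))) := by
  obtain ⟨v, τ, r, y, x, t, -, -, -, rfl, rfl, rfl, rfl, rfl, -, -, -⟩ :=
    exists_valuation (T := T) σ r y x t r r r
  simp only [← realize_meetB, ← realize_JB, ← realize_J'B, ← realize_e2B, ← realize_eApp]
  refine hB _ _ (fun v => ?_) v
  simp only [realize_meetB, realize_JB, realize_J'B, realize_e2B, realize_eApp]
  exact El.JB_J'B_e2B_le _ _ _ _ _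

theorem le_JB_J'B_e2B (hB : InVariety T B) (p q p' q' z t x : B) (σ : SIdx B) :
    let r := JB T p q z
    let y := KB T r q q'
    let s := meetB T x (meetB T t r)
    let w := meetB T (J'B T p' q' (eApp T σ s)) s
    meetB T w (JB T (J'B T r y (eApp T σ s)) y (e2B T r y s)) = w := by
  dsimp only
  obtain ⟨v, τ, p, q, p', q', z, t, x, rfl, rfl, rfl, rfl, rfl, rfl, rfl, rfl⟩ :=
    exists_valuation (T := T) σ p q p' q' z t x
  simp only [← realize_meetB, ← realize_JB, ← realize_J'B, ← realize_KB, ← realize_e2B,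
    ← realize_eApp]
  refine hB _ _ (fun v => ?_) v
  simp only [realize_meetB, realize_JB, realize_J'B, realize_KB, realize_e2B, realize_eApp]
  exact El.le_JB_J'B_e2B _ _ _ _ _ _ _ _

end InVariety

end

/-- Let `s ≤ t ≤ r` with `(r,t), (t,s) ∈ Cg^B(c,d)`, and
suppose `r = J(p₁,q₁,r)`, `t = J(p₁,q₁,t) = J'(p₂,q₂,t')`, `s = J'(p₂,q₂,s')`
where `t' = e_i(n̄,t)`, `s' = e_i(n̄,s)`.  Then there are `ρ, u ∈ B` with
`r = J'(r,ρ,r')`, `u = J'(r,ρ,s') = J(u,ρ,r'')` and `s = J(u,ρ,s'')`, where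
`r' = e_i(n̄,r)`, `r'' = e₂(r,ρ,r)`, `s'' = e₂(r,ρ,s)`; i.e. every `J`–`J'`
chain can be replaced by a `J'`–`J` chain with the same endpoints. -/
theorem J_J'_to_J'_J (T : TM) (B : Type*) [(Sig T).Structure B]
    (hB : InVariety T B)
    (c d r t s : B)
    (hst : leB T s t) (htr : leB T t r)
    (hrt : PrinCg (Sig T) B c d r t) (hts : PrinCg (Sig T) B c d t s)
    (p₁ p₂ q₁ q₂ : B) (σ : SIdx B)
    (h₁ : JB T p₁ q₁ r = r) (h₂ : JB T p₁ q₁ t = t)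
    (h₃ : J'B T p₂ q₂ (eApp T σ t) = t) (h₄ : J'B T p₂ q₂ (eApp T σ s) = s) :
    ∃ ρ u : B,
      J'B T r ρ (eApp T σ r) = r ∧
      J'B T r ρ (eApp T σ s) = u ∧
      JB T u ρ (e2B T r ρ r) = u ∧
      JB T u ρ (e2B T r ρ s) = s := by
  have hsr : meetB T s (meetB T t r) = s := by rw [htr, hst]
  refine ⟨KB T r q₁ q₂, _, ?_, rfl, hB.JB_J'B_e2B _ _ _, ?_⟩
  · have h_fix := hB.J'B_JB_JB p₁ q₁ r t
    have h_le := hB.J'B_le_J'B_KB p₁ q₁ p₂ q₂ r t σ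
    rw [h₁, h₂] at h_fix
    rw [h₁, h₂, h₃, h_fix] at h_le
    rw [← hB.meetB_J'B, h_le]
  · have h_le := hB.JB_J'B_e2B_le r (KB T r q₁ q₂) s t σ
    have h_ge := hB.le_JB_J'B_e2B p₁ q₁ p₂ q₂ r t s σ
    rw [hsr] at h_le
    dsimp only at h_ge
    rw [h₁, hsr, h₄, hB.meetB_self] at h_ge
    rw [← h_le, h_ge]

end McKenzie
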